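/- Let A be an antichain of [m]×[n] with cutting threshold q, and let A' = A ∩ ([a_q]×{b_q+1,...,n}), A'' = A ∩ ({a_q+1,...,m}×[b_q]) be the induced antichains from the cutting process. Then dim T_A = dim T_{A'} + dim T_{A''} + a_q(m − a_q) + b_q(n − b_q), where T denotes the degree-(0,0) part of Hom(J, S/J) at each Borel-fixed point in the respective rings. -/

import Mathlib

open MvPolynomial

/-- The bigrading on `k[x_1,…,x_m,y_1,…,y_n]`: `deg x_i = (1,0)`, `deg y_j = (0,1)`. -/
def wdeg (m n : ℕ) : (Fin m ⊕ Fin n) → ℕ × ℕ :=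
  Sum.elim (fun _ => ((1, 0) : ℕ × ℕ)) (fun _ => ((0, 1) : ℕ × ℕ))

/-- The monomial ideal of `k[x_1,…,x_m,y_1,…,y_n]` generated by the `x_i y_j` whose pair of
1-indexed labels lies in `O ⊆ ℕ × ℕ`. -/
noncomputable def Jof (k : Type*) [Field k] (m n : ℕ) (O : Set (ℕ × ℕ)) :
    Ideal (MvPolynomial (Fin m ⊕ Fin n) k) :=
  Ideal.span {p | ∃ (i : Fin m) (j : Fin n), ((i : ℕ) + 1, (j : ℕ) + 1) ∈ O ∧
    p = X (Sum.inl i) * X (Sum.inr j)}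

/-- The tangent space `T = [Hom_S(J, S/J)]_{(0,0)}`: the space of `S`-linear maps
`J → S/J` that preserve the bidegree (send each monomial of `J` to the class of a
bihomogeneous polynomial of the same bidegree). -/
noncomputable def TA (k : Type*) [Field k] (m n : ℕ) (O : Set (ℕ × ℕ)) :
    Submodule k (↥(Jof k m n O) →ₗ[MvPolynomial (Fin m ⊕ Fin n) k]
      (MvPolynomial (Fin m ⊕ Fin n) k ⧸ Jof k m n O)) where
  carrier := {φ | ∀ (u : (Fin m ⊕ Fin n) →₀ ℕ) (h : monomial u (1 : k) ∈ Jof k m n O),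
    ∃ p ∈ weightedHomogeneousSubmodule k (wdeg m n)
        (∑ i : Fin m, u (Sum.inl i), ∑ j : Fin n, u (Sum.inr j)),
      φ ⟨monomial u 1, h⟩ = Ideal.Quotient.mk (Jof k m n O) p}
  add_mem' := by
    intro φ ψ hφ hψ u h
    obtain ⟨p, hp, hvp⟩ := hφ u h
    obtain ⟨q, hq, hvq⟩ := hψ u h
    exact ⟨p + q, add_mem hp hq, by rw [LinearMap.add_apply, hvp, hvq, ← RingHom.map_add]⟩
  zero_mem' := by
    intro u h
    exact ⟨0, zero_mem _, by rw [LinearMap.zero_apply, RingHom.map_zero]⟩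
  smul_mem' := by
    intro c φ hφ u h
    obtain ⟨p, hp, hv⟩ := hφ u h
    refine ⟨c • p, Submodule.smul_mem _ c hp, ?_⟩
    rw [LinearMap.smul_apply, hv, ← Ideal.Quotient.mkₐ_eq_mk k, ← map_smul]

/-- The dimension of the tangent space at the Borel-fixed point `J`. -/
noncomputable def tdim (k : Type*) [Field k] (m n : ℕ) (O : Set (ℕ × ℕ)) : ℕ :=
  Module.finrank k ↥(TA k m n O)

/-- the exponent of `x_i y_j` -/
noncomputable def ee {m n : ℕ} (i : Fin m) (j : Fin n) : (Fin m ⊕ Fin n) →₀ ℕ :=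
  Finsupp.single (Sum.inl i) 1 + Finsupp.single (Sum.inr j) 1

lemma ee_inl {m n : ℕ} (i : Fin m) (j : Fin n) (i' : Fin m) :
    ee i j (Sum.inl i') = if i = i' then 1 else 0 := by
  simp [ee, Finsupp.single_apply]

lemma ee_inr {m n : ℕ} (i : Fin m) (j : Fin n) (j' : Fin n) :
    ee i j (Sum.inr j') = if j = j' then 1 else 0 := by
  simp [ee, Finsupp.single_apply]

lemma ee_inj {m n : ℕ} (i k : Fin m) (j l : Fin n) : ee i j = ee k l ↔ i = k ∧ j = l := by
  constructor
  · intro h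
    have h1 := DFunLike.congr_fun h (Sum.inl i)
    have h2 := DFunLike.congr_fun h (Sum.inr j)
    simp only [ee_inl, ee_inr] at h1 h2
    constructor
    · by_contra hc
      rw [if_pos trivial, if_neg (fun h => hc h.symm)] at h1
      omega
    · by_contra hc
      rw [if_pos trivial, if_neg (fun h => hc h.symm)] at h2
      omega
  · rintro ⟨rfl, rfl⟩; rfl

lemma ee_le {m n : ℕ} (i : Fin m) (j : Fin n) (u : (Fin m ⊕ Fin n) →₀ ℕ) :
    ee i j ≤ u ↔ 1 ≤ u (Sum.inl i) ∧ 1 ≤ u (Sum.inr j) := by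
  constructor
  · intro h
    have h1 := h (Sum.inl i)
    have h2 := h (Sum.inr j)
    simp only [ee_inl, ee_inr, if_true] at h1 h2
    exact ⟨h1, h2⟩
  · rintro ⟨h1, h2⟩ v
    rcases v with v | v
    · rw [ee_inl]; split_ifs with h
      · subst h; exact h1
      · omega
    · rw [ee_inr]; split_ifs with h
      · subst h; exact h2
      · omega

def PO (O : Set (ℕ × ℕ)) (i j : ℕ) : Prop := (i + 1, j + 1) ∈ O

def inJ {m n : ℕ} (O : Set (ℕ × ℕ)) (u : (Fin m ⊕ Fin n) →₀ ℕ) : Prop :=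
  ∃ (i : Fin m) (j : Fin n), PO O i j ∧ 1 ≤ u (Sum.inl i) ∧ 1 ≤ u (Sum.inr j)

lemma inJ_ee {m n : ℕ} (O : Set (ℕ × ℕ)) (i : Fin m) (j : Fin n) :
    inJ O (ee i j) ↔ PO O i j := by
  constructor
  · rintro ⟨i', j', h, h1, h2⟩
    rw [ee_inl] at h1
    rw [ee_inr] at h2
    have h3 : i = i' := by by_contra hc; simp [hc] at h1
    have h4 : j = j' := by by_contra hc; simp [hc] at h2
    subst h3; subst h4; exact h
  · intro h
    exact ⟨i, j, h, by simp [ee_inl], by simp [ee_inr]⟩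

lemma inJ_mono {m n : ℕ} {O : Set (ℕ × ℕ)} {u v : (Fin m ⊕ Fin n) →₀ ℕ} (h : u ≤ v)
    (hu : inJ O u) : inJ O v := by
  obtain ⟨i, j, hp, h1, h2⟩ := hu
  exact ⟨i, j, hp, h1.trans (h _), h2.trans (h _)⟩

section alg
variable {k : Type*} [Field k] {m n : ℕ} {O : Set (ℕ × ℕ)}

lemma mono_ee (i : Fin m) (j : Fin n) :
    (monomial (ee i j) (1 : k)) = X (Sum.inl i) * X (Sum.inr j) := by
  simp [ee, X, monomial_mul]

lemma mem_Jof (f : MvPolynomial (Fin m ⊕ Fin n) k) :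
    f ∈ Jof k m n O ↔ ∀ u ∈ f.support, inJ O u := by
  have : Jof k m n O = Ideal.span ((fun s => monomial s (1 : k)) ''
      {e : (Fin m ⊕ Fin n) →₀ ℕ | ∃ (i : Fin m) (j : Fin n), PO O i j ∧ e = ee i j}) := by
    unfold Jof
    congr 1
    ext p
    constructor
    · rintro ⟨i, j, h, rfl⟩
      exact ⟨_, ⟨i, j, h, rfl⟩, mono_ee i j⟩
    · rintro ⟨_, ⟨i, j, h, rfl⟩, rfl⟩
      exact ⟨i, j, h, mono_ee i j⟩
  rw [this, mem_ideal_span_monomial_image]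
  refine forall₂_congr fun u _ => ?_
  constructor
  · rintro ⟨_, ⟨i, j, h, rfl⟩, hle⟩
    rw [ee_le] at hle
    exact ⟨i, j, h, hle⟩
  · rintro ⟨i, j, h, hle⟩
    exact ⟨_, ⟨i, j, h, rfl⟩, (ee_le i j u).2 hle⟩

lemma mono_mem (u : (Fin m ⊕ Fin n) →₀ ℕ) (c : k) (h : inJ O u) :
    monomial u c ∈ Jof k m n O := by
  rw [mem_Jof]
  intro v hv
  have := support_monomial_subset hv
  rw [Finset.mem_singleton] at this
  rwa [this]

lemma inJ_of_mono_mem (u : (Fin m ⊕ Fin n) →₀ ℕ) (h : monomial u (1 : k) ∈ Jof k m n O) :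
    inJ O u := by
  rw [mem_Jof] at h
  exact h u (by simp [mem_support_iff])

lemma coeff_eq_zero_of_mem {t : (Fin m ⊕ Fin n) →₀ ℕ} (ht : ¬ inJ O t)
    {f : MvPolynomial (Fin m ⊕ Fin n) k} (hf : f ∈ Jof k m n O) : coeff t f = 0 := by
  by_contra hc
  exact ht ((mem_Jof f).1 hf t (mem_support_iff.2 hc))

lemma coeff_eq_of_mk {t : (Fin m ⊕ Fin n) →₀ ℕ} (ht : ¬ inJ O t)
    {f g : MvPolynomial (Fin m ⊕ Fin n) k}
    (h : Ideal.Quotient.mk (Jof k m n O) f = Ideal.Quotient.mk (Jof k m n O) g) :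
    coeff t f = coeff t g := by
  rw [Ideal.Quotient.eq] at h
  have := coeff_eq_zero_of_mem ht h
  rwa [coeff_sub, sub_eq_zero] at this

lemma exists_cf (t : (Fin m ⊕ Fin n) →₀ ℕ) (ht : ¬ inJ O t) :
    ∃ c : (MvPolynomial (Fin m ⊕ Fin n) k ⧸ Jof k m n O) →ₗ[k] k,
      ∀ f, c (Ideal.Quotient.mk (Jof k m n O) f) = coeff t f := by
  have key : ∀ f, coeff t (Quotient.out (Ideal.Quotient.mk (Jof k m n O) f)) = coeff t f := by
    intro f
    apply coeff_eq_of_mk ht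
    exact Quotient.out_eq _
  refine ⟨{ toFun := fun x => coeff t (Quotient.out x), map_add' := ?_, map_smul' := ?_ }, key⟩
  · intro x y
    obtain ⟨f, rfl⟩ := Ideal.Quotient.mk_surjective x
    obtain ⟨g, rfl⟩ := Ideal.Quotient.mk_surjective y
    rw [← RingHom.map_add, key, key, key, coeff_add]
  · intro c x
    obtain ⟨f, rfl⟩ := Ideal.Quotient.mk_surjective x
    have : c • Ideal.Quotient.mk (Jof k m n O) f = Ideal.Quotient.mk (Jof k m n O) (c • f) := by
      rw [← Ideal.Quotient.mkₐ_eq_mk k, ← map_smul]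
    rw [this, key, key, coeff_smul]; rfl

noncomputable def cf (t : (Fin m ⊕ Fin n) →₀ ℕ) (ht : ¬ inJ O t) :
    (MvPolynomial (Fin m ⊕ Fin n) k ⧸ Jof k m n O) →ₗ[k] k := (exists_cf t ht).choose

lemma cf_mk (t : (Fin m ⊕ Fin n) →₀ ℕ) (ht : ¬ inJ O t) (f : MvPolynomial (Fin m ⊕ Fin n) k) :
    cf t ht (Ideal.Quotient.mk (Jof k m n O) f) = coeff t f := (exists_cf t ht).choose_spec f

lemma rel {φ : ↥(Jof k m n O) →ₗ[MvPolynomial (Fin m ⊕ Fin n) k]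
      (MvPolynomial (Fin m ⊕ Fin n) k ⧸ Jof k m n O)}
    {U V v w t : (Fin m ⊕ Fin n) →₀ ℕ} (hU : monomial U (1 : k) ∈ Jof k m n O)
    (hV : monomial V (1 : k) ∈ Jof k m n O) (hvw : v + U = w + V) (ht : ¬ inJ O t)
    {p r : MvPolynomial (Fin m ⊕ Fin n) k}
    (hp : φ ⟨_, hU⟩ = Ideal.Quotient.mk _ p) (hr : φ ⟨_, hV⟩ = Ideal.Quotient.mk _ r) :
    coeff t (monomial v 1 * p) = coeff t (monomial w 1 * r) := by
  apply coeff_eq_of_mk ht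
  have h1 : (monomial v (1 : k)) • (⟨_, hU⟩ : ↥(Jof k m n O)) =
      (monomial w (1 : k)) • (⟨_, hV⟩ : ↥(Jof k m n O)) := by
    apply Subtype.ext
    simp [monomial_mul, hvw]
  have h2 := congrArg φ h1
  rw [map_smul, map_smul, hp, hr] at h2
  rw [RingHom.map_mul, RingHom.map_mul]
  exact h2

lemma weight_eq (u : (Fin m ⊕ Fin n) →₀ ℕ) :
    Finsupp.weight (wdeg m n) u = (∑ i : Fin m, u (Sum.inl i), ∑ j : Fin n, u (Sum.inr j)) := by
  rw [Finsupp.weight_apply, Finsupp.sum_fintype _ _ (by simp), Fintype.sum_sum_type]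
  ext <;> simp [wdeg, Prod.fst_sum, Prod.snd_sum]

lemma weight_ee (i : Fin m) (j : Fin n) : Finsupp.weight (wdeg m n) (ee i j) = (1, 1) := by
  simp [ee, wdeg, Finsupp.weight_single]

lemma sum_one {N : ℕ} (f : Fin N → ℕ) (h : ∑ i, f i = 1) :
    ∃ i, ∀ i', f i' = if i = i' then 1 else 0 := by
  have h0 : ∃ i, f i ≠ 0 := by
    by_contra hc
    push Not at hc
    simp [hc] at h
  obtain ⟨i, hi⟩ := h0
  refine ⟨i, fun i' => ?_⟩
  have h1 := Finset.add_sum_erase Finset.univ f (Finset.mem_univ i)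
  by_cases hii : i = i'
  · subst hii
    simp only [if_true]; omega
  · have := Finset.single_le_sum (f := f) (s := Finset.univ.erase i) (fun _ _ => Nat.zero_le _)
      (Finset.mem_erase.2 ⟨fun h => hii h.symm, Finset.mem_univ i'⟩)
    simp only [hii, if_false]; omega

lemma eq_ee_of_weight (t : (Fin m ⊕ Fin n) →₀ ℕ) (h : Finsupp.weight (wdeg m n) t = (1, 1)) :
    ∃ i j, t = ee i j := by
  rw [weight_eq, Prod.mk.injEq] at h
  obtain ⟨i, hi⟩ := sum_one _ h.1
  obtain ⟨j, hj⟩ := sum_one _ h.2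
  refine ⟨i, j, ?_⟩
  ext v
  rcases v with v | v
  · rw [hi, ee_inl]
  · rw [hj, ee_inr]

/-- general constructor of tangent vectors -/
lemma mkT (D : MvPolynomial (Fin m ⊕ Fin n) k →ₗ[k] MvPolynomial (Fin m ⊕ Fin n) k)
    (H : ∀ g, ∀ f ∈ Jof k m n O, D (g * f) - g * D f ∈ Jof k m n O)
    (hw : ∀ u, D (monomial u 1) ∈
      weightedHomogeneousSubmodule k (wdeg m n) (Finsupp.weight (wdeg m n) u)) :
    ∃ φ ∈ TA k m n O, ∀ f, φ f = Ideal.Quotient.mk _ (D f.1) := by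
  refine ⟨{ toFun := fun f => Ideal.Quotient.mk _ (D f.1), map_add' := ?_, map_smul' := ?_ },
    ?_, fun f => rfl⟩
  · intro x y
    simp
  · intro g x
    rw [RingHom.id_apply]
    have := (Ideal.Quotient.eq (I := Jof k m n O)).2 (H g x.1 x.2)
    rw [RingHom.map_mul] at this
    exact this
  · intro u h
    refine ⟨D (monomial u 1), ?_, rfl⟩
    rw [← weight_eq]
    exact hw u

end alg

section alg2
variable {k : Type*} [Field k] {m n : ℕ} {O : Set (ℕ × ℕ)}

lemma H_of_mono (D : MvPolynomial (Fin m ⊕ Fin n) k →ₗ[k] MvPolynomial (Fin m ⊕ Fin n) k)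
    (h : ∀ v u, inJ O u → D (monomial (v + u) 1) - monomial v 1 * D (monomial u 1) ∈ Jof k m n O) :
    ∀ g, ∀ f ∈ Jof k m n O, D (g * f) - g * D f ∈ Jof k m n O := by
  have h1 : ∀ v, ∀ f ∈ Jof k m n O, D (monomial v 1 * f) - monomial v 1 * D f ∈ Jof k m n O := by
    intro v f hf
    have e : D (monomial v 1 * f) - monomial v 1 * D f = ∑ u ∈ f.support,
        C (coeff u f) * (D (monomial (v + u) 1) - monomial v 1 * D (monomial u 1)) := by
      conv_lhs => rw [f.as_sum]
      rw [Finset.mul_sum, map_sum, map_sum, Finset.mul_sum, ← Finset.sum_sub_distrib]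
      refine Finset.sum_congr rfl fun u _ => ?_
      have e1 : monomial u (coeff u f) = coeff u f • monomial u (1 : k) := by
        simp [smul_monomial]
      have e2 : monomial (v + u) (1 : k) = monomial v 1 * monomial u 1 := by simp [monomial_mul]
      rw [e1, e2, mul_smul_comm, map_smul, map_smul, mul_smul_comm, ← smul_sub, C_mul']
    rw [e]
    exact Ideal.sum_mem _ fun u hu => Ideal.mul_mem_left _ _ (h v u ((mem_Jof f).1 hf u hu))
  intro g f hf
  induction g using MvPolynomial.induction_on' with
  | monomial v c =>
    have e1 : monomial v c = c • monomial v (1 : k) := by simp [smul_monomial]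
    rw [e1, smul_mul_assoc, map_smul, smul_mul_assoc, ← smul_sub, ← C_mul']
    exact Ideal.mul_mem_left _ _ (h1 v f hf)
  | add p q hp hq =>
    rw [add_mul, map_add, add_mul, add_sub_add_comm]
    exact add_mem hp hq

lemma weight_swap (u : (Fin m ⊕ Fin n) →₀ ℕ) (d e : (Fin m ⊕ Fin n) →₀ ℕ) (hd : d ≤ u)
    (hde : Finsupp.weight (wdeg m n) d = Finsupp.weight (wdeg m n) e) :
    Finsupp.weight (wdeg m n) (u - d + e) = Finsupp.weight (wdeg m n) u := by
  conv_rhs => rw [← tsub_add_cancel_of_le hd]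
  rw [map_add, map_add, hde]

lemma der_hom (s t : Fin m ⊕ Fin n) (hst : wdeg m n s = wdeg m n t)
    (u : (Fin m ⊕ Fin n) →₀ ℕ) :
    ((X t : MvPolynomial (Fin m ⊕ Fin n) k) • pderiv s (monomial u (1 : k))) ∈
      weightedHomogeneousSubmodule k (wdeg m n) (Finsupp.weight (wdeg m n) u) := by
  rw [pderiv_monomial, smul_eq_mul, mem_weightedHomogeneousSubmodule]
  by_cases hu : u s = 0
  · simp [hu, isWeightedHomogeneous_zero]
  · rw [X, monomial_mul]
    apply isWeightedHomogeneous_monomial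
    rw [add_comm]
    apply weight_swap
    · intro v
      rw [Finsupp.single_apply]
      split_ifs with h
      · subst h; omega
      · omega
    · simp [Finsupp.weight_single, hst]

lemma der_T (s t : Fin m ⊕ Fin n) (hst : wdeg m n s = wdeg m n t) :
    ∃ φ ∈ TA k m n O, ∀ f, φ f = Ideal.Quotient.mk _
      ((X t : MvPolynomial (Fin m ⊕ Fin n) k) * pderiv s f.1) := by
  obtain ⟨φ, h1, h2⟩ := mkT (k := k) (O := O)
    (((X t : MvPolynomial (Fin m ⊕ Fin n) k) • pderiv s :
      Derivation k (MvPolynomial (Fin m ⊕ Fin n) k) (MvPolynomial (Fin m ⊕ Fin n) k)) :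
      MvPolynomial (Fin m ⊕ Fin n) k →ₗ[k] MvPolynomial (Fin m ⊕ Fin n) k) (by
        intro g f hf
        simp only [Derivation.coeFn_coe, Derivation.leibniz, smul_eq_mul, add_sub_cancel_left]
        exact Ideal.mul_mem_right _ _ hf) (by
        intro u
        exact der_hom s t hst u)
  exact ⟨φ, h1, h2⟩

lemma T_x (i i₂ : Fin m) : ∃ φ ∈ TA k m n O, ∀ (i' : Fin m) (j' : Fin n)
    (h : monomial (ee i' j') (1 : k) ∈ Jof k m n O),
    φ ⟨_, h⟩ = Ideal.Quotient.mk _ (if i = i' then monomial (ee i₂ j') 1 else 0) := by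
  obtain ⟨φ, h1, h2⟩ := der_T (k := k) (O := O) (Sum.inl i : Fin m ⊕ Fin n) (Sum.inl i₂) rfl
  refine ⟨φ, h1, fun i' j' h => ?_⟩
  rw [h2]
  congr 1
  simp only [mono_ee]
  split_ifs with hi
  · subst hi; simp [pderiv_X]
  · simp [pderiv_X, Pi.single_apply, Ne.symm hi]

lemma T_y (j j₂ : Fin n) : ∃ φ ∈ TA k m n O, ∀ (i' : Fin m) (j' : Fin n)
    (h : monomial (ee i' j') (1 : k) ∈ Jof k m n O),
    φ ⟨_, h⟩ = Ideal.Quotient.mk _ (if j = j' then monomial (ee i' j₂) 1 else 0) := by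
  obtain ⟨φ, h1, h2⟩ := der_T (k := k) (O := O) (Sum.inr j : Fin m ⊕ Fin n) (Sum.inr j₂) rfl
  refine ⟨φ, h1, fun i' j' h => ?_⟩
  rw [h2]
  congr 1
  simp only [mono_ee]
  split_ifs with hi
  · subst hi; simp [pderiv_X]; ring
  · simp [pderiv_X, Pi.single_apply, Ne.symm hi]

def Quad (O : Set (ℕ × ℕ)) {m n : ℕ} (i : Fin m) (j : Fin n) (k : Fin m) (l : Fin n) : Prop :=
  PO O i j ∧ ¬ PO O k l ∧ k ≠ i ∧ l ≠ j ∧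
  (∀ i' : Fin m, i' ≠ i → PO O i' j → PO O i' l) ∧
  (∀ j' : Fin n, j' ≠ j → PO O i j' → PO O k j')

lemma T_q (i i₂ : Fin m) (j j₂ : Fin n) (hq : Quad O i j i₂ j₂) :
    ∃ φ ∈ TA k m n O, ∀ (i' : Fin m) (j' : Fin n)
    (h : monomial (ee i' j') (1 : k) ∈ Jof k m n O),
    φ ⟨_, h⟩ = Ideal.Quotient.mk _ (if i = i' ∧ j = j' then monomial (ee i₂ j₂) 1 else 0) := by
  classical
  obtain ⟨hO, hO2, hne1, hne2, hc1, hc2⟩ := hq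
  set D : MvPolynomial (Fin m ⊕ Fin n) k →ₗ[k] MvPolynomial (Fin m ⊕ Fin n) k :=
    (basisMonomials (Fin m ⊕ Fin n) k).constr k
      (fun u => if ee i j ≤ u then monomial (u - ee i j + ee i₂ j₂) (1 : k) else 0) with hD
  have Dm : ∀ u, D (monomial u 1) =
      if ee i j ≤ u then monomial (u - ee i j + ee i₂ j₂) (1 : k) else 0 := by
    intro u
    have := (basisMonomials (Fin m ⊕ Fin n) k).constr_basis k
      (fun u => if ee i j ≤ u then monomial (u - ee i j + ee i₂ j₂) (1 : k) else 0) u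
    rwa [coe_basisMonomials] at this
  obtain ⟨φ, h1, h2⟩ := mkT (k := k) (O := O) D (H_of_mono D (by
    intro v u hu
    rw [Dm, Dm]
    by_cases h : ee i j ≤ u
    · rw [if_pos h, if_pos (h.trans le_add_self), monomial_mul, one_mul, add_tsub_assoc_of_le h,
        add_assoc, sub_self]
      exact zero_mem _
    · rw [if_neg h, mul_zero, sub_zero]
      split_ifs with h'
      · apply mono_mem
        obtain ⟨i', j', hp, hi', hj'⟩ := hu
        rw [ee_le] at h
        by_cases hii : i' = i
        · subst hii
          have hjj : j' ≠ j := by rintro rfl; exact h ⟨hi', hj'⟩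
          refine ⟨i₂, j', hc2 j' hjj hp, ?_, ?_⟩
          · simp [ee_inl]
          · simp [ee_inr, Ne.symm hjj]; omega
        · by_cases hjj : j' = j
          · subst hjj
            refine ⟨i', j₂, hc1 i' hii hp, ?_, ?_⟩
            · simp [ee_inl, Ne.symm hii]; omega
            · simp [ee_inr]
          · refine ⟨i', j', hp, ?_, ?_⟩
            · simp [ee_inl, Ne.symm hii]; omega
            · simp [ee_inr, Ne.symm hjj]; omega
      · exact zero_mem _)) (by
    intro u
    rw [Dm]
    split_ifs with h
    · apply isWeightedHomogeneous_monomial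
      exact weight_swap _ _ _ h (by rw [weight_ee, weight_ee])
    · exact zero_mem _)
  refine ⟨φ, h1, fun i' j' h => ?_⟩
  rw [h2]
  congr 1
  rw [Dm]
  by_cases he : i = i' ∧ j = j'
  · obtain ⟨rfl, rfl⟩ := he
    simp
  · rw [if_neg he, if_neg]
    rw [ee_le, ee_inl, ee_inr]
    rintro ⟨q1, q2⟩
    apply he
    constructor
    · by_contra hc; simp [Ne.symm hc] at q1
    · by_contra hc; simp [Ne.symm hc] at q2

end alg2

section alg3
variable {k : Type*} [Field k] {m n : ℕ} {O : Set (ℕ × ℕ)}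

abbrev Ix (O : Set (ℕ × ℕ)) (m n : ℕ) : Type :=
  {p : Fin m × Fin m // ∃ j : Fin n, PO O p.1 j ∧ ¬ PO O p.2 j}

abbrev Iy (O : Set (ℕ × ℕ)) (m n : ℕ) : Type :=
  {p : Fin n × Fin n // ∃ i : Fin m, PO O i p.1 ∧ ¬ PO O i p.2}

abbrev Iq (O : Set (ℕ × ℕ)) (m n : ℕ) : Type :=
  {p : (Fin m × Fin n) × (Fin m × Fin n) // Quad O p.1.1 p.1.2 p.2.1 p.2.2}

abbrev II (O : Set (ℕ × ℕ)) (m n : ℕ) : Type := Ix O m n ⊕ Iy O m n ⊕ Iq O m n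

noncomputable def dat : II O m n → (Fin m × Fin n) × (Fin m × Fin n)
  | Sum.inl p => ((p.1.1, p.2.choose), (p.1.2, p.2.choose))
  | Sum.inr (Sum.inl p) => ((p.2.choose, p.1.1), (p.2.choose, p.1.2))
  | Sum.inr (Sum.inr p) => p.1

lemma dat_spec (ι : II O m n) : PO O (dat ι).1.1 (dat ι).1.2 ∧ ¬ PO O (dat ι).2.1 (dat ι).2.2 := by
  rcases ι with p | p | p
  · exact p.2.choose_spec
  · exact p.2.choose_spec
  · exact ⟨p.2.1, p.2.2.1⟩

lemma gen_mem {i : Fin m} {j : Fin n} (h : PO O i j) : monomial (ee i j) (1 : k) ∈ Jof k m n O :=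
  mono_mem _ _ ((inJ_ee O i j).2 h)

noncomputable def Phi (k : Type*) [Field k] (O : Set (ℕ × ℕ)) (m n : ℕ) :
    ↥(TA k m n O) →ₗ[k] (II O m n → k) :=
  LinearMap.pi fun ι =>
    { toFun := fun φ => cf (ee (dat ι).2.1 (dat ι).2.2)
        (fun h => (dat_spec ι).2 ((inJ_ee _ _ _).1 h))
        (φ.1 ⟨monomial (ee (dat ι).1.1 (dat ι).1.2) 1, gen_mem (dat_spec ι).1⟩)
      map_add' := by intro x y; simp
      map_smul' := by intro c x; simp }

lemma Phi_apply (φ : ↥(TA k m n O)) (ι : II O m n) (p : MvPolynomial (Fin m ⊕ Fin n) k)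
    (h : φ.1 ⟨monomial (ee (dat ι).1.1 (dat ι).1.2) 1, gen_mem (dat_spec ι).1⟩ =
      Ideal.Quotient.mk _ p) : Phi k O m n φ ι = coeff (ee (dat ι).2.1 (dat ι).2.2) p := by
  change cf _ _ _ = _
  rw [h, cf_mk]

lemma Phi_surj : Function.Surjective (Phi k O m n) := by
  classical
  have key : ∀ ι : II O m n, ∃ φ, Phi k O m n φ = Pi.single ι 1 := by
    intro ι
    rcases ι with p | p | p
    · obtain ⟨φ, hφ, h⟩ := T_x (k := k) (O := O) (n := n) p.1.1 p.1.2
      refine ⟨⟨φ, hφ⟩, ?_⟩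
      ext ι'
      rw [Phi_apply _ ι' _ (h _ _ _)]
      have hp : p.1.1 ≠ p.1.2 := by
        intro e; obtain ⟨j, h1, h2⟩ := p.2; rw [e] at h1; exact h2 h1
      rcases ι' with p' | p' | p'
      · rw [Pi.single_apply]
        have : (Sum.inl p' : II O m n) = Sum.inl p ↔ p.1.1 = p'.1.1 ∧ p.1.2 = p'.1.2 := by
          rw [Sum.inl.injEq, Subtype.ext_iff, Prod.ext_iff, eq_comm, @eq_comm _ p'.1.2]
        by_cases h1 : p.1.1 = p'.1.1 <;> by_cases h2 : p.1.2 = p'.1.2 <;>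
          simp [this, dat, h1, h2, coeff_monomial, ee_inj]
      · have hp' : p'.1.1 ≠ p'.1.2 := by
          intro e; obtain ⟨j, h1, h2⟩ := p'.2; rw [e] at h1; exact h2 h1
        by_cases h1 : p.1.1 = p'.2.choose <;>
          simp [dat, h1, coeff_monomial, ee_inj, hp']
      · have hp' := p'.2.2.2.2.1.symm
        by_cases h1 : p.1.1 = p'.1.1.1 <;>
          simp [dat, h1, coeff_monomial, ee_inj, hp']
    · obtain ⟨φ, hφ, h⟩ := T_y (k := k) (O := O) (m := m) p.1.1 p.1.2
      refine ⟨⟨φ, hφ⟩, ?_⟩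
      ext ι'
      rw [Phi_apply _ ι' _ (h _ _ _)]
      rcases ι' with p' | p' | p'
      · have hp' : p'.1.1 ≠ p'.1.2 := by
          intro e; obtain ⟨j, h1, h2⟩ := p'.2; rw [e] at h1; exact h2 h1
        by_cases h1 : p.1.1 = p'.2.choose <;>
          simp [dat, h1, coeff_monomial, ee_inj, hp']
      · rw [Pi.single_apply]
        have : (Sum.inr (Sum.inl p') : II O m n) = Sum.inr (Sum.inl p) ↔
            p.1.1 = p'.1.1 ∧ p.1.2 = p'.1.2 := by
          rw [Sum.inr.injEq, Sum.inl.injEq, Subtype.ext_iff, Prod.ext_iff, eq_comm,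
            @eq_comm _ p'.1.2]
        by_cases h1 : p.1.1 = p'.1.1 <;> by_cases h2 : p.1.2 = p'.1.2 <;>
          simp [this, dat, h1, h2, coeff_monomial, ee_inj]
      · have hp' := p'.2.2.2.1.symm
        by_cases h1 : p.1.1 = p'.1.1.2 <;>
          simp [dat, h1, coeff_monomial, ee_inj, hp']
    · obtain ⟨φ, hφ, h⟩ := T_q (k := k) (O := O) _ _ _ _ p.2
      refine ⟨⟨φ, hφ⟩, ?_⟩
      ext ι'
      rw [Phi_apply _ ι' _ (h _ _ _)]
      have hp1 := p.2.2.2.1.symm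
      have hp2 := p.2.2.2.2.1.symm
      rcases ι' with p' | p' | p'
      · by_cases h1 : p.1.1.1 = p'.1.1 ∧ p.1.1.2 = p'.2.choose
        · have : p.1.2.2 ≠ p'.2.choose := fun h => hp2 (h1.2.trans h.symm)
          simp [dat, h1, coeff_monomial, ee_inj, this]
        · simp [dat, h1]
      · by_cases h1 : p.1.1.1 = p'.2.choose ∧ p.1.1.2 = p'.1.1
        · have : p.1.2.1 ≠ p'.2.choose := fun h => hp1 (h1.1.trans h.symm)
          simp [dat, h1, coeff_monomial, ee_inj, this]
        · simp [dat, h1]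
      · rw [Pi.single_apply]
        have : (Sum.inr (Sum.inr p') : II O m n) = Sum.inr (Sum.inr p) ↔
            (p.1.1.1 = p'.1.1.1 ∧ p.1.1.2 = p'.1.1.2) ∧
              (p.1.2.1 = p'.1.2.1 ∧ p.1.2.2 = p'.1.2.2) := by
          rw [Sum.inr.injEq, Sum.inr.injEq, eq_comm, Subtype.ext_iff, Prod.ext_iff, Prod.ext_iff,
            Prod.ext_iff]
        by_cases h1 : p.1.1.1 = p'.1.1.1 ∧ p.1.1.2 = p'.1.1.2 <;>
          by_cases h2 : p.1.2.1 = p'.1.2.1 ∧ p.1.2.2 = p'.1.2.2 <;>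
          simp [this, dat, h1, h2, coeff_monomial, ee_inj]
  intro f
  choose g hg using key
  refine ⟨∑ ι, f ι • g ι, ?_⟩
  rw [map_sum]
  ext ι
  simp [hg, Finset.sum_apply, Pi.single_apply]

lemma Phi_inj : Function.Injective (Phi k O m n) := by
  rw [injective_iff_map_eq_zero]
  intro φ hφ
  have hex : ∀ (i : Fin m) (j : Fin n), ∃ p : MvPolynomial (Fin m ⊕ Fin n) k,
      ∀ h : PO O i j, IsWeightedHomogeneous (wdeg m n) p ((1, 1) : ℕ × ℕ) ∧
        φ.1 ⟨monomial (ee i j) 1, gen_mem h⟩ = Ideal.Quotient.mk _ p := by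
    intro i j
    by_cases h : PO O i j
    · obtain ⟨p, hp, hv⟩ := φ.2 _ (gen_mem (k := k) h)
      rw [← weight_eq, weight_ee] at hp
      exact ⟨p, fun _ => ⟨hp, hv⟩⟩
    · exact ⟨0, fun h' => (h h').elim⟩
  choose p hp using hex
  have hz : ∀ ι : II O m n, coeff (ee (dat ι).2.1 (dat ι).2.2) (p (dat ι).1.1 (dat ι).1.2) = 0 := by
    intro ι
    rw [← Phi_apply φ ι _ (hp _ _ (dat_spec ι).1).2, hφ]; rfl
  -- the relations
  have nin1 : ∀ (i' i : Fin m) (l : Fin n), ¬ PO O i' l → ¬ PO O i l →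
      ¬ inJ O (Finsupp.single (Sum.inl i') 1 + ee i l) := by
    rintro i' i l h1 h2 ⟨a, b, hab, ha, hb⟩
    have hbl : l = b := by
      by_contra hc
      simp [ee_inr, hc] at hb
    subst hbl
    by_cases e1 : i' = a
    · subst e1; exact h1 hab
    · by_cases e2 : i = a
      · subst e2; exact h2 hab
      · simp [ee_inl, e1, e2] at ha
  have nin2 : ∀ (j' j : Fin n) (i : Fin m), ¬ PO O i j' → ¬ PO O i j →
      ¬ inJ O (Finsupp.single (Sum.inr j') 1 + ee i j) := by
    rintro j' j i h1 h2 ⟨a, b, hab, ha, hb⟩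
    have hai : i = a := by
      by_contra hc
      simp [ee_inl, hc] at ha
    subst hai
    by_cases e1 : j' = b
    · subst e1; exact h1 hab
    · by_cases e2 : j = b
      · subst e2; exact h2 hab
      · simp [ee_inr, e1, e2] at hb
  have R1 : ∀ (i i' r : Fin m) (j l : Fin n), PO O i j → PO O i' j → ¬ PO O i' l → ¬ PO O r l →
      i' ≠ i → r ≠ i → coeff (ee r l) (p i j) = 0 := by
    intro i i' r j l h1 h2 h3 h4 h5 h6
    have := rel (t := Finsupp.single (Sum.inl i') 1 + ee r l)
      (v := Finsupp.single (Sum.inl i') 1) (w := Finsupp.single (Sum.inl i) 1)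
      (gen_mem (k := k) h1) (gen_mem (k := k) h2) (by unfold ee; abel) (nin1 _ _ _ h3 h4)
      (hp _ _ h1).2 (hp _ _ h2).2
    rw [coeff_monomial_mul, one_mul, coeff_monomial_mul', if_neg] at this
    · exact this
    · intro hle
      have := hle (Sum.inl i)
      simp [ee_inl, h5, h6] at this
  have R1' : ∀ (i r : Fin m) (j j' l : Fin n), PO O i j → PO O i j' → ¬ PO O r j' → ¬ PO O r l →
      j' ≠ j → l ≠ j → coeff (ee r l) (p i j) = 0 := by
    intro i r j j' l h1 h2 h3 h4 h5 h6
    have := rel (t := Finsupp.single (Sum.inr j') 1 + ee r l)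
      (v := Finsupp.single (Sum.inr j') 1) (w := Finsupp.single (Sum.inr j) 1)
      (gen_mem (k := k) h1) (gen_mem (k := k) h2) (by unfold ee; abel) (nin2 _ _ _ h3 h4)
      (hp _ _ h1).2 (hp _ _ h2).2
    rw [coeff_monomial_mul, one_mul, coeff_monomial_mul', if_neg] at this
    · exact this
    · intro hle
      have := hle (Sum.inr j)
      simp [ee_inr, h5, h6] at this
  have R2 : ∀ (i i' : Fin m) (j l : Fin n), PO O i j → PO O i' j → ¬ PO O i' l → ¬ PO O i l →
      coeff (ee i l) (p i j) = coeff (ee i' l) (p i' j) := by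
    intro i i' j l h1 h2 h3 h4
    have := rel (t := Finsupp.single (Sum.inl i') 1 + ee i l)
      (v := Finsupp.single (Sum.inl i') 1) (w := Finsupp.single (Sum.inl i) 1)
      (gen_mem (k := k) h1) (gen_mem (k := k) h2) (by unfold ee; abel) (nin1 _ _ _ h3 h4)
      (hp _ _ h1).2 (hp _ _ h2).2
    have e : Finsupp.single (Sum.inl i') 1 + ee i l = Finsupp.single (Sum.inl i) 1 + ee i' l := by
      unfold ee; abel
    rw [coeff_monomial_mul, one_mul, e, coeff_monomial_mul, one_mul] at this
    exact this
  have R2' : ∀ (i r : Fin m) (j j' : Fin n), PO O i j → PO O i j' → ¬ PO O r j' → ¬ PO O r j →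
      coeff (ee r j) (p i j) = coeff (ee r j') (p i j') := by
    intro i r j j' h1 h2 h3 h4
    have := rel (t := Finsupp.single (Sum.inr j') 1 + ee r j)
      (v := Finsupp.single (Sum.inr j') 1) (w := Finsupp.single (Sum.inr j) 1)
      (gen_mem (k := k) h1) (gen_mem (k := k) h2) (by unfold ee; abel) (nin2 _ _ _ h3 h4)
      (hp _ _ h1).2 (hp _ _ h2).2
    have e : Finsupp.single (Sum.inr j') 1 + ee r j = Finsupp.single (Sum.inr j) 1 + ee r j' := by
      unfold ee; abel
    rw [coeff_monomial_mul, one_mul, e, coeff_monomial_mul, one_mul] at this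
    exact this
  have Z : ∀ (i r : Fin m) (j l : Fin n), PO O i j → ¬ PO O r l → coeff (ee r l) (p i j) = 0 := by
    intro i r j l h1 h2
    by_cases hi : r = i
    · subst hi
      have hx : ∃ i : Fin m, PO O i (j, l).1 ∧ ¬ PO O i (j, l).2 := ⟨r, h1, h2⟩
      rw [R2 r hx.choose j l h1 hx.choose_spec.1 hx.choose_spec.2 h2]
      exact hz (Sum.inr (Sum.inl ⟨(j, l), hx⟩))
    by_cases hj : l = j
    · subst hj
      have hx : ∃ j : Fin n, PO O (i, r).1 j ∧ ¬ PO O (i, r).2 j := ⟨l, h1, h2⟩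
      rw [R2' i r l hx.choose h1 hx.choose_spec.1 hx.choose_spec.2 h2]
      exact hz (Sum.inl ⟨(i, r), hx⟩)
    by_cases hQ : Quad O i j r l
    · exact hz (Sum.inr (Sum.inr ⟨((i, j), (r, l)), hQ⟩))
    by_contra hc
    apply hQ
    refine ⟨h1, h2, hi, hj, ?_, ?_⟩
    · intro i' h3 h4
      by_contra h5
      exact hc (R1 i i' r j l h1 h4 h5 h2 h3 hi)
    · intro j' h3 h4
      by_contra h5
      exact hc (R1' i r j j' l h1 h4 h5 h2 h3 hj)
  have G : ∀ (i : Fin m) (j : Fin n) (h : PO O i j),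
      φ.1 ⟨monomial (ee i j) 1, gen_mem h⟩ = 0 := by
    intro i j h
    rw [(hp i j h).2, Ideal.Quotient.eq_zero_iff_mem, mem_Jof]
    intro t ht
    rw [mem_support_iff] at ht
    obtain ⟨r, l, rfl⟩ := eq_ee_of_weight t ((hp i j h).1 ht)
    rw [inJ_ee]
    by_contra hc
    exact ht (Z i r j l h hc)
  apply Subtype.ext
  apply LinearMap.ext
  rintro ⟨f, hf⟩
  change φ.1 ⟨f, hf⟩ = 0
  unfold Jof at hf
  refine Submodule.span_induction (p := fun f hf => φ.1 ⟨f, hf⟩ = 0) ?_ ?_ ?_ ?_ hf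
  · rintro _ ⟨i, j, h, rfl⟩
    have := G i j h
    simp only [mono_ee] at this
    exact this
  · exact map_zero _
  · intro x y hx hy h1 h2
    have := map_add φ.1 ⟨x, hx⟩ ⟨y, hy⟩
    rw [h1, h2, add_zero] at this
    exact this
  · intro c x hx h1
    have := map_smul φ.1 c ⟨x, hx⟩
    rw [h1, smul_zero] at this
    exact this

open Classical in
lemma tdim_eq : tdim k m n O =
    (∑ i : Fin m, ∑ r : Fin m, if ∃ j : Fin n, PO O i j ∧ ¬ PO O r j then 1 else 0) +
    (∑ j : Fin n, ∑ l : Fin n, if ∃ i : Fin m, PO O i j ∧ ¬ PO O i l then 1 else 0) +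
    (∑ i : Fin m, ∑ j : Fin n, ∑ r : Fin m, ∑ l : Fin n, if Quad O i j r l then 1 else 0) := by
  unfold tdim
  rw [(LinearEquiv.ofBijective (Phi k O m n) ⟨Phi_inj, Phi_surj⟩).finrank_eq,
    Module.finrank_fintype_fun_eq_card, Fintype.card_sum, Fintype.card_sum, ← add_assoc,
    Fintype.card_subtype, Fintype.card_subtype, Fintype.card_subtype, Finset.card_filter,
    Finset.card_filter, Finset.card_filter]
  simp only [Fintype.sum_prod_type]

end alg3

lemma Quad_blocks {α β m' n' : ℕ} {O : Set (ℕ × ℕ)} (hα : 1 ≤ α) (hβ : 1 ≤ β)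
    (low : ∀ i j i' j', PO O i j → i' ≤ i → j' ≤ j → PO O i' j')
    (h1 : ∀ i j, i < α → j < β → PO O i j)
    (h2 : ∀ i j, α ≤ i → β ≤ j → ¬ PO O i j)
    (hx : ∀ l, β ≤ l → ¬ PO O (α - 1) l) (hy : ∀ r, α ≤ r → ¬ PO O r (β - 1))
    (hc : ∀ r l, α ≤ r → r < α + m' → β ≤ l → l < β + n' →
      (∀ i, i < α - 1 → PO O i l) → (∀ j, j < β - 1 → PO O r j) → False)
    (i : Fin (α + m')) (j : Fin (β + n')) (r : Fin (α + m')) (l : Fin (β + n'))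
    (h : Quad O i j r l) :
    ((i : ℕ) < α ∧ β ≤ (j : ℕ) ∧ (r : ℕ) < α ∧ β ≤ (l : ℕ)) ∨
      (α ≤ (i : ℕ) ∧ (j : ℕ) < β ∧ α ≤ (r : ℕ) ∧ (l : ℕ) < β) := by
  obtain ⟨q1, q2, q3, q4, q5, q6⟩ := h
  have q3' : (r : ℕ) ≠ i := fun e => q3 (Fin.ext e)
  have q4' : (l : ℕ) ≠ j := fun e => q4 (Fin.ext e)
  have q5' : ∀ i' : ℕ, i' < α + m' → i' ≠ i → PO O i' j → PO O i' l := fun i' hi' hne =>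
    q5 ⟨i', hi'⟩ (fun e => hne (congrArg Fin.val e))
  have q6' : ∀ j' : ℕ, j' < β + n' → j' ≠ j → PO O i j' → PO O r j' := fun j' hj' hne =>
    q6 ⟨j', hj'⟩ (fun e => hne (congrArg Fin.val e))
  have bi := i.2
  have bj := j.2
  have br := r.2
  have bl := l.2
  clear q3 q4 q5 q6
  generalize (i : ℕ) = i at *
  generalize (j : ℕ) = j at *
  generalize (r : ℕ) = r at *
  generalize (l : ℕ) = l at *
  have hjl : j < l := by
    by_contra hn
    exact q2 (q6' l bl q4' (low _ _ _ _ q1 le_rfl (by omega)))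
  have hir : i < r := by
    by_contra hn
    exact q2 (q5' r br q3' (low _ _ _ _ q1 (by omega) le_rfl))
  by_cases hi : i < α
  · by_cases hj : j < β
    · exfalso
      have hl : β ≤ l → i = α - 1 := by
        intro hl
        by_contra hne
        exact hx l hl (q5' (α - 1) (by omega) (by omega) (h1 _ _ (by omega) hj))
      have hr : α ≤ r → j = β - 1 := by
        intro hr
        by_contra hne
        exact hy r hr (q6' (β - 1) (by omega) (by omega) (h1 _ _ hi (by omega)))
      have hor : α ≤ r ∨ β ≤ l := by
        by_contra hn
        push Not at hn
        exact q2 (h1 _ _ hn.1 hn.2)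
      have hr' : α ≤ r := by omega
      have hl' : β ≤ l := by omega
      refine hc r l hr' br hl' bl ?_ ?_
      · intro i' hi'
        exact q5' i' (by omega) (by omega) (h1 _ _ (by omega) hj)
      · intro j' hj'
        exact q6' j' (by omega) (by omega) (h1 _ _ hi (by omega))
    · left
      refine ⟨hi, by omega, ?_, by omega⟩
      by_contra hr
      exact hy r (by omega) (q6' (β - 1) (by omega) (by omega) (h1 _ _ hi (by omega)))
  · by_cases hj : j < β
    · right
      refine ⟨by omega, hj, by omega, ?_⟩
      by_contra hl
      exact hx l (by omega) (q5' (α - 1) (by omega) (by omega) (h1 _ _ (by omega) hj))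
    · exact (h2 _ _ (by omega) (by omega) q1).elim

lemma cut_main {k : Type*} [Field k] {α β m' n' : ℕ} {O O' O'' : Set (ℕ × ℕ)}
    (hα : 1 ≤ α) (hβ : 1 ≤ β)
    (low : ∀ i j i' j', PO O i j → i' ≤ i → j' ≤ j → PO O i' j')
    (h1 : ∀ i j, i < α → j < β → PO O i j)
    (h2 : ∀ i j, α ≤ i → β ≤ j → ¬ PO O i j)
    (h3 : ∀ i j, i < α → (PO O' i j ↔ PO O i (β + j)))
    (h4 : ∀ i j, j < β → (PO O'' i j ↔ PO O (α + i) j))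
    (hx : ∀ l, β ≤ l → ¬ PO O (α - 1) l) (hy : ∀ r, α ≤ r → ¬ PO O r (β - 1))
    (hc : ∀ r l, α ≤ r → r < α + m' → β ≤ l → l < β + n' →
      (∀ i, i < α - 1 → PO O i l) → (∀ j, j < β - 1 → PO O r j) → False) :
    tdim k (α + m') (β + n') O = tdim k α n' O' + tdim k m' β O'' + α * m' + β * n' := by
  classical
  have QB := Quad_blocks (m' := m') (n' := n') hα hβ low h1 h2 hx hy hc
  have exn : ∀ (p : Fin (β + n') → Prop), (∃ j, p j) ↔
      (∃ j : Fin β, p (Fin.castAdd n' j)) ∨ (∃ j : Fin n', p (Fin.natAdd β j)) := by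
    intro p
    constructor
    · rintro ⟨j, hj⟩
      refine Fin.addCases (motive := fun j => p j → _) ?_ ?_ j hj
      · exact fun j hj => Or.inl ⟨j, hj⟩
      · exact fun j hj => Or.inr ⟨j, hj⟩
    · rintro (⟨j, hj⟩ | ⟨j, hj⟩) <;> exact ⟨_, hj⟩
  have exm : ∀ (p : Fin (α + m') → Prop), (∃ j, p j) ↔
      (∃ j : Fin α, p (Fin.castAdd m' j)) ∨ (∃ j : Fin m', p (Fin.natAdd α j)) := by
    intro p
    constructor
    · rintro ⟨j, hj⟩
      refine Fin.addCases (motive := fun j => p j → _) ?_ ?_ j hj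
      · exact fun j hj => Or.inl ⟨j, hj⟩
      · exact fun j hj => Or.inr ⟨j, hj⟩
    · rintro (⟨j, hj⟩ | ⟨j, hj⟩) <;> exact ⟨_, hj⟩
  -- x-linear blocks
  have x00 : ∀ i r : Fin α, (∃ j : Fin (β + n'), PO O (Fin.castAdd m' i : Fin (α + m')) j ∧
      ¬ PO O (Fin.castAdd m' r : Fin (α + m')) j) ↔ ∃ j : Fin n', PO O' i j ∧ ¬ PO O' r j := by
    intro i r
    rw [exn]
    simp only [Fin.val_castAdd, Fin.val_natAdd, h3 _ _ i.2, h3 _ _ r.2]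
    constructor
    · rintro (⟨j, _, h⟩ | h)
      · exact (h (h1 _ _ r.2 j.2)).elim
      · exact h
    · exact Or.inr
  have x11 : ∀ i r : Fin m', (∃ j : Fin (β + n'), PO O (Fin.natAdd α i : Fin (α + m')) j ∧
      ¬ PO O (Fin.natAdd α r : Fin (α + m')) j) ↔ ∃ j : Fin β, PO O'' i j ∧ ¬ PO O'' r j := by
    intro i r
    rw [exn]
    simp only [Fin.val_castAdd, Fin.val_natAdd]
    constructor
    · rintro (⟨j, h⟩ | ⟨j, h, _⟩)
      · exact ⟨j, by rwa [h4 _ _ j.2, h4 _ _ j.2]⟩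
      · exact (h2 _ _ (by omega) (by omega) h).elim
    · rintro ⟨j, h⟩
      rw [h4 _ _ j.2, h4 _ _ j.2] at h
      exact Or.inl ⟨j, h⟩
  have x01 : ∀ (i : Fin α) (r : Fin m'), ∃ j : Fin (β + n'),
      PO O (Fin.castAdd m' i : Fin (α + m')) j ∧ ¬ PO O (Fin.natAdd α r : Fin (α + m')) j := by
    intro i r
    refine ⟨⟨β - 1, by omega⟩, h1 _ _ i.2 (by simp; omega), hy _ (by simp)⟩
  have x10 : ∀ (i : Fin m') (r : Fin α), ¬ ∃ j : Fin (β + n'),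
      PO O (Fin.natAdd α i : Fin (α + m')) j ∧ ¬ PO O (Fin.castAdd m' r : Fin (α + m')) j := by
    rintro i r ⟨j, h, h'⟩
    exact h' (low _ _ _ _ h (by simp; omega) le_rfl)
  -- y-linear blocks
  have y00 : ∀ j l : Fin β, (∃ i : Fin (α + m'), PO O i (Fin.castAdd n' j : Fin (β + n')) ∧
      ¬ PO O i (Fin.castAdd n' l : Fin (β + n'))) ↔ ∃ i : Fin m', PO O'' i j ∧ ¬ PO O'' i l := by
    intro j l
    rw [exm]
    simp only [Fin.val_castAdd, Fin.val_natAdd, h4 _ _ j.2, h4 _ _ l.2]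
    constructor
    · rintro (⟨i, _, h⟩ | h)
      · exact (h (h1 _ _ i.2 l.2)).elim
      · exact h
    · exact Or.inr
  have y11 : ∀ j l : Fin n', (∃ i : Fin (α + m'), PO O i (Fin.natAdd β j : Fin (β + n')) ∧
      ¬ PO O i (Fin.natAdd β l : Fin (β + n'))) ↔ ∃ i : Fin α, PO O' i j ∧ ¬ PO O' i l := by
    intro j l
    rw [exm]
    simp only [Fin.val_castAdd, Fin.val_natAdd]
    constructor
    · rintro (⟨i, h⟩ | ⟨i, h, _⟩)
      · exact ⟨i, by rwa [h3 _ _ i.2, h3 _ _ i.2]⟩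
      · exact (h2 _ _ (by omega) (by omega) h).elim
    · rintro ⟨i, h⟩
      rw [h3 _ _ i.2, h3 _ _ i.2] at h
      exact Or.inl ⟨i, h⟩
  have y01 : ∀ (j : Fin β) (l : Fin n'), ∃ i : Fin (α + m'),
      PO O i (Fin.castAdd n' j : Fin (β + n')) ∧ ¬ PO O i (Fin.natAdd β l : Fin (β + n')) := by
    intro j l
    refine ⟨⟨α - 1, by omega⟩, h1 _ _ (by simp; omega) j.2, hx _ (by simp)⟩
  have y10 : ∀ (j : Fin n') (l : Fin β), ¬ ∃ i : Fin (α + m'),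
      PO O i (Fin.natAdd β j : Fin (β + n')) ∧ ¬ PO O i (Fin.castAdd n' l : Fin (β + n')) := by
    rintro j l ⟨i, h, h'⟩
    exact h' (low _ _ _ _ h le_rfl (by simp; omega))
  -- quadratic blocks
  have q00 : ∀ (i : Fin α) (j : Fin β) r l,
      ¬ Quad O (Fin.castAdd m' i) (Fin.castAdd n' j) r l := by
    intro i j r l h
    have := QB _ _ _ _ h
    simp at this; omega
  have q11 : ∀ (i : Fin m') (j : Fin n') r l,
      ¬ Quad O (Fin.natAdd α i) (Fin.natAdd β j) r l := by
    intro i j r l h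
    have := QB _ _ _ _ h
    simp at this
  have q01a : ∀ (i : Fin α) (j : Fin n') (r : Fin m') l,
      ¬ Quad O (Fin.castAdd m' i) (Fin.natAdd β j) (Fin.natAdd α r) l := by
    intro i j r l h
    have := QB _ _ _ _ h
    simp at this
  have q01b : ∀ (i : Fin α) (j : Fin n') r (l : Fin β),
      ¬ Quad O (Fin.castAdd m' i) (Fin.natAdd β j) r (Fin.castAdd n' l) := by
    intro i j r l h
    have := QB _ _ _ _ h
    simp at this; omega
  have q10a : ∀ (i : Fin m') (j : Fin β) (r : Fin α) l,
      ¬ Quad O (Fin.natAdd α i) (Fin.castAdd n' j) (Fin.castAdd m' r) l := by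
    intro i j r l h
    have := QB _ _ _ _ h
    simp at this; omega
  have q10b : ∀ (i : Fin m') (j : Fin β) r (l : Fin n'),
      ¬ Quad O (Fin.natAdd α i) (Fin.castAdd n' j) r (Fin.natAdd β l) := by
    intro i j r l h
    have := QB _ _ _ _ h
    simp at this
  have q01 : ∀ (i : Fin α) (j : Fin n') (r : Fin α) (l : Fin n'),
      Quad O (Fin.castAdd m' i) (Fin.natAdd β j) (Fin.castAdd m' r) (Fin.natAdd β l) ↔
        Quad O' i j r l := by
    intro i j r l
    unfold Quad
    simp only [h3 _ _ i.2, h3 _ _ r.2, Fin.val_castAdd, Fin.val_natAdd, ne_eq,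
      Fin.castAdd_inj, Fin.natAdd_inj]
    refine and_congr_right fun _ => and_congr_right fun _ => and_congr_right fun _ =>
      and_congr_right fun _ => and_congr ?_ ?_
    · constructor
      · intro h i' hne
        rw [h3 _ _ i'.2, h3 _ _ i'.2]
        exact h (Fin.castAdd m' i') (by simpa using hne)
      · intro h i'
        refine Fin.addCases (fun i' => ?_) (fun i' => ?_) i'
        · intro hne
          have := h i' (by simpa using hne)
          rw [h3 _ _ i'.2, h3 _ _ i'.2] at this
          exact this
        · intro _ h5
          exact (h2 _ _ (by simp) (by simp) h5).elim
    · constructor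
      · intro h j' hne
        exact h (Fin.natAdd β j') (by simpa using hne)
      · intro h j'
        refine Fin.addCases (fun j' => ?_) (fun j' => ?_) j'
        · intro _ _
          exact h1 _ _ r.2 (by simp)
        · intro hne
          exact h j' (by simpa using hne)
  have q10 : ∀ (i : Fin m') (j : Fin β) (r : Fin m') (l : Fin β),
      Quad O (Fin.natAdd α i) (Fin.castAdd n' j) (Fin.natAdd α r) (Fin.castAdd n' l) ↔
        Quad O'' i j r l := by
    intro i j r l
    unfold Quad
    simp only [h4 _ _ j.2, h4 _ _ l.2, Fin.val_castAdd, Fin.val_natAdd, ne_eq,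
      Fin.castAdd_inj, Fin.natAdd_inj]
    refine and_congr_right fun _ => and_congr_right fun _ => and_congr_right fun _ =>
      and_congr_right fun _ => and_congr ?_ ?_
    · constructor
      · intro h i' hne
        exact h (Fin.natAdd α i') (by simpa using hne)
      · intro h i'
        refine Fin.addCases (fun i' => ?_) (fun i' => ?_) i'
        · intro _ _
          exact h1 _ _ (by simp) l.2
        · intro hne
          exact h i' (by simpa using hne)
    · constructor
      · intro h j' hne
        rw [h4 _ _ j'.2, h4 _ _ j'.2]
        exact h (Fin.castAdd n' j') (by simpa using hne)
      · intro h j'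
        refine Fin.addCases (fun j' => ?_) (fun j' => ?_) j'
        · intro hne
          have := h j' (by simpa using hne)
          rw [h4 _ _ j'.2, h4 _ _ j'.2] at this
          exact this
        · intro _ h5
          exact (h2 _ _ (by simp) (by simp) h5).elim
  rw [tdim_eq, tdim_eq, tdim_eq]
  simp only [Fin.sum_univ_add, x00, x11, x01, x10, y00, y11, y01, y10, q00, q11, q01a, q01b,
    q10a, q10b, q01, q10, if_true, if_false, Finset.sum_const_zero, add_zero, zero_add,
    Finset.sum_add_distrib, Finset.sum_const, Finset.card_univ, Fintype.card_fin, smul_eq_mul,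
    mul_one]
  ring

/-- Cutting process tangent space decomposition: for an antichain `A` of `[m] × [n]` with
cutting threshold `q`, and the induced antichains `A'`, `A''` (living in
`[a_q] × {b_q+1,…,n}` and `{a_q+1,…,m} × [b_q]`, relabelled to `[a_q] × [n−b_q]` and
`[m−a_q] × [b_q]`), one has
`dim T_A = dim T_{A'} + dim T_{A''} + a_q(m − a_q) + b_q(n − b_q)`. -/
theorem stmt14 {k : Type*} [Field k] (m n s q : ℕ) (a b : ℕ → ℕ)
    (ha0 : a 0 = 0) (haS : a (s + 1) = m) (hb0 : b 0 = n) (hbS : b (s + 1) = 0)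
    (ha : ∀ i, 1 ≤ i → i ≤ s → 1 ≤ a i ∧ a i ≤ m)
    (hb : ∀ i, 1 ≤ i → i ≤ s → 1 ≤ b i ∧ b i ≤ n)
    (hamono : ∀ i j, 1 ≤ i → i < j → j ≤ s → a i < a j)
    (hbanti : ∀ i j, 1 ≤ i → i < j → j ≤ s → b j < b i)
    (hqs : q ≤ s)
    (hct : ∀ i, q + 1 ≤ i → i ≤ s →
      a i < m ∧ b i < n ∧ a i = a (i - 1) + 1 ∧ b i = b (i + 1) + 1)
    (hctmin : ∀ t < q, ¬ ∀ i, t + 1 ≤ i → i ≤ s →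
      a i < m ∧ b i < n ∧ a i = a (i - 1) + 1 ∧ b i = b (i + 1) + 1) :
    tdim k m n {v | ∃ ℓ, 1 ≤ ℓ ∧ ℓ ≤ s ∧ v.1 ≤ a ℓ ∧ v.2 ≤ b ℓ} =
      tdim k (a q) (n - b q)
        {v | ∃ ℓ, 1 ≤ ℓ ∧ ℓ ≤ q - 1 ∧ v.1 ≤ a ℓ ∧ v.2 + b q ≤ b ℓ} +
      tdim k (m - a q) (b q)
        {v | ∃ ℓ, q + 1 ≤ ℓ ∧ ℓ ≤ s ∧ v.1 + a q ≤ a ℓ ∧ v.2 ≤ b ℓ} +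
      a q * (m - a q) + b q * (n - b q) := by
  rcases Nat.eq_zero_or_pos q with hq0 | hq0
  · subst hq0
    rw [ha0, hb0]
    have z1 : ∀ O : Set (ℕ × ℕ), tdim k 0 (n - n) O = 0 := by
      intro O
      rw [Nat.sub_self, tdim_eq]
      simp
    rw [z1, Nat.sub_zero, Nat.sub_self]
    simp
  have hA := ha q hq0 hqs
  have hB := hb q hq0 hqs
  have hcor : ¬ (a q < m ∧ b q < n ∧ a q = a (q - 1) + 1 ∧ b q = b (q + 1) + 1) := by
    intro h
    refine hctmin (q - 1) (by omega) fun i h1 h2 => ?_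
    by_cases hi : i = q
    · subst hi; exact h
    · exact hct i (by omega) h2
  have hb_gt : ∀ ℓ, 1 ≤ ℓ → ℓ ≤ s → b q < b ℓ → ℓ < q := by
    intro ℓ h1 h2 h3
    by_contra hn
    by_cases he : ℓ = q
    · subst he; omega
    · have := hbanti q ℓ hq0 (by omega) h2
      omega
  have ha_gt : ∀ ℓ, 1 ≤ ℓ → ℓ ≤ s → a q < a ℓ → q < ℓ := by
    intro ℓ h1 h2 h3
    by_contra hn
    by_cases he : ℓ = q
    · subst he; omega
    · have := hamono ℓ q h1 (by omega) hqs
      omega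
  have hb_le : ∀ ℓ, q < ℓ → ℓ ≤ s → b ℓ < b q := fun ℓ h1 h2 => hbanti q ℓ hq0 h1 h2
  have ha_le : ∀ ℓ, 1 ≤ ℓ → ℓ < q → a ℓ < a q := fun ℓ h1 h2 => hamono ℓ q h1 h2 hqs
  have main := cut_main (k := k) (α := a q) (β := b q) (m' := m - a q) (n' := n - b q)
    (O := {v | ∃ ℓ, 1 ≤ ℓ ∧ ℓ ≤ s ∧ v.1 ≤ a ℓ ∧ v.2 ≤ b ℓ})
    (O' := {v | ∃ ℓ, 1 ≤ ℓ ∧ ℓ ≤ q - 1 ∧ v.1 ≤ a ℓ ∧ v.2 + b q ≤ b ℓ})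
    (O'' := {v | ∃ ℓ, q + 1 ≤ ℓ ∧ ℓ ≤ s ∧ v.1 + a q ≤ a ℓ ∧ v.2 ≤ b ℓ})
    hA.1 hB.1 ?_ ?_ ?_ ?_ ?_ ?_ ?_ ?_
  · rw [Nat.add_sub_cancel' hA.2, Nat.add_sub_cancel' hB.2] at main
    exact main
  · rintro i j i' j' ⟨ℓ, h1, h2, h3, h4⟩ hi hj
    exact ⟨ℓ, h1, h2, by simp only at h3 ⊢; omega, by simp only at h4 ⊢; omega⟩
  · intro i j hi hj
    exact ⟨q, hq0, hqs, hi, hj⟩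
  · rintro i j hi hj ⟨ℓ, h1, h2, h3, h4⟩
    simp only at h3 h4
    have e1 := ha_gt ℓ h1 h2 (by omega)
    have e2 := hb_gt ℓ h1 h2 (by omega)
    omega
  · intro i j hi
    constructor
    · rintro ⟨ℓ, h1, h2, h3, h4⟩
      simp only at h3 h4
      exact ⟨ℓ, h1, by omega, h3, by simp only; omega⟩
    · rintro ⟨ℓ, h1, h2, h3, h4⟩
      simp only at h3 h4
      have := hb_gt ℓ h1 h2 (by omega)
      exact ⟨ℓ, h1, by omega, h3, by simp only; omega⟩
  · intro i j hj
    constructor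
    · rintro ⟨ℓ, h1, h2, h3, h4⟩
      simp only at h3 h4
      exact ⟨ℓ, by omega, h2, by simp only; omega, h4⟩
    · rintro ⟨ℓ, h1, h2, h3, h4⟩
      simp only at h3 h4
      have := ha_gt ℓ h1 h2 (by omega)
      exact ⟨ℓ, by omega, h2, by simp only; omega, h4⟩
  · rintro l hl ⟨ℓ, h1, h2, h3, h4⟩
    simp only at h3 h4
    have e2 := hb_gt ℓ h1 h2 (by omega)
    have e3 := ha_le ℓ h1 e2
    omega
  · rintro r hr ⟨ℓ, h1, h2, h3, h4⟩
    simp only at h3 h4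
    have e2 := ha_gt ℓ h1 h2 (by omega)
    have e3 := hb_le ℓ e2 h2
    omega
  · intro r l hr hr' hl hl' hi hj
    apply hcor
    refine ⟨by omega, by omega, ?_, ?_⟩
    · by_cases h1 : q = 1
      · subst h1
        simp only [Nat.sub_self, ha0]
        by_contra hne
        obtain ⟨ℓ, g1, g2, g3, g4⟩ := hi 0 (by omega)
        simp only at g3 g4
        have := hb_gt ℓ g1 g2 (by omega)
        omega
      · have f1 := ha_le (q - 1) (by omega) (by omega)
        have f2 := ha (q - 1) (by omega) (by omega)
        obtain ⟨ℓ, g1, g2, g3, g4⟩ := hi (a q - 2) (by omega)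
        simp only at g3 g4
        have g5 := hb_gt ℓ g1 g2 (by omega)
        by_cases g6 : ℓ = q - 1
        · subst g6; omega
        · have := hamono ℓ (q - 1) g1 (by omega) (by omega)
          omega
    · by_cases h1 : q = s
      · subst h1
        rw [hbS]
        by_contra hne
        obtain ⟨ℓ, g1, g2, g3, g4⟩ := hj 0 (by omega)
        simp only at g3 g4
        have := ha_gt ℓ g1 g2 (by omega)
        omega
      · have f1 := hb_le (q + 1) (by omega) (by omega)
        have f2 := hb (q + 1) (by omega) (by omega)
        obtain ⟨ℓ, g1, g2, g3, g4⟩ := hj (b q - 2) (by omega)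
        simp only at g3 g4
        have g5 := ha_gt ℓ g1 g2 (by omega)
        by_cases g6 : ℓ = q + 1
        · subst g6; omega
        · have := hbanti (q + 1) ℓ (by omega) (by omega) g2
          omega
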